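/- Let v > 4 be an odd integer with prime factorization v = p₁^{n₁}···p_k^{n_k} in which every prime p_i ≡ 1 (mod 3). Then the number of orbits of the affine group AGL₁(v) = { x ↦ ax + b : a ∈ Z_v*, b ∈ Z_v } acting on B_con(v,3) — equivalently, the number of isomorphism classes of connected cyclic configurations of type (v_3) — equals (1/6)·v·∏_{i=1}^{k}(1 + 1/p_i) + (5/6)·2^k − 2. -/

import Mathlib

open scoped Pointwise

/-- `B_con(v,3)`: base lines of connected cyclic configurations of type (v₃). -/
def Bcon3 (v : ℕ) : Set (Finset (ZMod v)) :=
  {X | X.card = 3 ∧ (X - X).card = 7 ∧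
    AddSubgroup.closure ((X - X : Finset (ZMod v)) : Set (ZMod v)) = ⊤}

/-- The orbit relation of the affine group `AGL₁(v)` acting on `B_con(v,3)` by
`X ↦ aX + b`. -/
def affRel3 (v : ℕ) (X Y : Bcon3 v) : Prop :=
  ∃ a : (ZMod v)ˣ, ∃ b : ZMod v,
    (Y : Finset (ZMod v)) = (X : Finset (ZMod v)).image (fun t => (a : ZMod v) * t + b)

/-- The number of orbits of `AGL₁(v)` on `B_con(v,3)`, i.e. the number of isomorphism
classes of connected cyclic configurations of type (v₃). -/
noncomputable def numOrbits3 (v : ℕ) : ℕ :=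
  Nat.card (Quot (affRel3 v))

/-! ### Counting solutions over `ZMod v` -/

theorem Prod.isCoprime_iff {R S : Type*} [CommSemiring R] [CommSemiring S] {x y : R × S} :
    IsCoprime x y ↔ IsCoprime x.1 y.1 ∧ IsCoprime x.2 y.2 := by
  constructor
  · rintro ⟨a, b, h⟩
    exact ⟨⟨a.1, b.1, congrArg Prod.fst h⟩, ⟨a.2, b.2, congrArg Prod.snd h⟩⟩
  · rintro ⟨⟨a, b, h⟩, ⟨c, d, h'⟩⟩
    exact ⟨(a, c), (b, d), Prod.ext h h'⟩

theorem ZMod.card_sq_eq_one_mul {m n : ℕ} (h : m.Coprime n) :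
    Nat.card {u : ZMod (m * n) // u ^ 2 = 1} =
      Nat.card {u : ZMod m // u ^ 2 = 1} * Nat.card {u : ZMod n // u ^ 2 = 1} := by
  rw [← Nat.card_prod]
  refine Nat.card_congr (((ZMod.chineseRemainder h).toEquiv.subtypeEquiv fun u => ?_).trans
    (Equiv.subtypeProdEquivProd (p := fun u : ZMod m => u ^ 2 = 1)
      (q := fun u : ZMod n => u ^ 2 = 1)))
  rw [← (ZMod.chineseRemainder h).injective.eq_iff]
  simp [Prod.ext_iff]

theorem ZMod.card_one_add_add_sq_eq_zero_mul {m n : ℕ} (h : m.Coprime n) :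
    Nat.card {u : ZMod (m * n) // 1 + u + u ^ 2 = 0} =
      Nat.card {u : ZMod m // 1 + u + u ^ 2 = 0} *
        Nat.card {u : ZMod n // 1 + u + u ^ 2 = 0} := by
  rw [← Nat.card_prod]
  refine Nat.card_congr (((ZMod.chineseRemainder h).toEquiv.subtypeEquiv fun u => ?_).trans
    (Equiv.subtypeProdEquivProd (p := fun u : ZMod m => 1 + u + u ^ 2 = 0)
      (q := fun u : ZMod n => 1 + u + u ^ 2 = 0)))
  rw [← (ZMod.chineseRemainder h).injective.eq_iff]
  simp [Prod.ext_iff]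

theorem ZMod.card_isCoprime_mul {m n : ℕ} (h : m.Coprime n) :
    Nat.card {x : ZMod (m * n) × ZMod (m * n) // IsCoprime x.1 x.2} =
      Nat.card {x : ZMod m × ZMod m // IsCoprime x.1 x.2} *
        Nat.card {x : ZMod n × ZMod n // IsCoprime x.1 x.2} := by
  rw [← Nat.card_prod]
  let e := (ZMod.chineseRemainder h)
  refine Nat.card_congr ((((e.toEquiv.prodCongr e.toEquiv).trans
    (Equiv.prodProdProdComm _ _ _ _)).subtypeEquiv fun x => ?_).trans
    (Equiv.subtypeProdEquivProd (p := fun x : ZMod m × ZMod m => IsCoprime x.1 x.2)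
      (q := fun x : ZMod n × ZMod n => IsCoprime x.1 x.2)))
  have : IsCoprime x.1 x.2 ↔ IsCoprime (e x.1) (e x.2) :=
    ⟨fun hx => hx.map e.toRingHom, fun hx => by simpa using hx.map e.symm.toRingHom⟩
  rw [this, Prod.isCoprime_iff]
  rfl

theorem ZMod.isLocalRing_prime_pow {p n : ℕ} (hp : p.Prime) (hn : n ≠ 0) :
    IsLocalRing (ZMod (p ^ n)) := by
  have : Fact p.Prime := ⟨hp⟩
  have : Fact (1 < p ^ n) := ⟨Nat.one_lt_pow hn hp.one_lt⟩
  exact IsLocalRing.of_surjective' (PadicInt.toZModPow (p := p) n) (ZMod.ringHom_surjective _)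

theorem IsLocalRing.isCoprime_iff {R : Type*} [CommRing R] [IsLocalRing R] {x y : R} :
    IsCoprime x y ↔ IsUnit x ∨ IsUnit y := by
  constructor
  · rintro ⟨a, b, h⟩
    exact (IsLocalRing.isUnit_or_isUnit_of_add_one h).imp isUnit_of_mul_isUnit_right
      isUnit_of_mul_isUnit_right
  · rintro (h | h)
    · obtain ⟨u, rfl⟩ := h
      exact ⟨↑u⁻¹, 0, by simp⟩
    · obtain ⟨u, rfl⟩ := h
      exact ⟨0, ↑u⁻¹, by simp⟩

/-- In a local ring, two roots whose difference is a unit are the only roots of the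
corresponding quadratic polynomial. -/
theorem IsLocalRing.card_quadratic_roots {R : Type*} [CommRing R] [IsLocalRing R]
    {r s : R} (h : IsUnit (r - s)) : Nat.card {u : R // (u - r) * (u - s) = 0} = 2 := by
  have hne : r ≠ s := by
    rintro rfl
    simp at h
  have : {u : R | (u - r) * (u - s) = 0} = {r, s} := by
    ext u
    simp only [Set.mem_ofPred_eq, Set.mem_insert_iff, Set.mem_singleton_iff]
    constructor
    · intro hu
      have hadd : IsUnit ((u - s) + -(u - r)) := by
        convert h using 1
        ring
      rcases IsLocalRing.isUnit_or_isUnit_of_isUnit_add hadd with h' | h'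
      · exact .inl (sub_eq_zero.mp ((h'.mul_left_eq_zero).mp hu))
      · exact .inr (sub_eq_zero.mp (((IsUnit.neg_iff _).mp h').mul_right_eq_zero.mp hu))
    · rintro (rfl | rfl) <;> simp
  change Nat.card ({u : R | (u - r) * (u - s) = 0} : Set R) = 2
  rw [this, Nat.card_coe_set_eq, Set.ncard_pair hne]

theorem ZMod.isUnit_natCast_prime_pow {p n q : ℕ} (hp : p.Prime) (hq : q.Prime) (h : p ≠ q) :
    IsUnit ((q : ℕ) : ZMod (p ^ n)) :=
  (ZMod.isUnit_iff_coprime _ _).mpr (((Nat.coprime_primes hq hp).mpr h.symm).pow_right n)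

theorem ZMod.card_sq_eq_one_prime_pow {p n : ℕ} (hp : p.Prime) (hn : n ≠ 0) (h2 : p ≠ 2) :
    Nat.card {u : ZMod (p ^ n) // u ^ 2 = 1} = 2 := by
  have := ZMod.isLocalRing_prime_pow hp hn
  have h : IsUnit ((1 : ZMod (p ^ n)) - (-1)) := by
    convert ZMod.isUnit_natCast_prime_pow (n := n) hp Nat.prime_two h2 using 1
    push_cast
    ring
  refine (Nat.card_congr (Equiv.subtypeEquivRight fun u => ?_)).trans
    (IsLocalRing.card_quadratic_roots h)
  rw [← sub_eq_zero]
  ring_nf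

theorem ZMod.exists_one_add_add_sq_eq_zero {p n : ℕ} (hp : p.Prime) (hn : n ≠ 0)
    (h3 : p % 3 = 1) : ∃ w : ZMod (p ^ n), 1 + w + w ^ 2 = 0 := by
  have := ZMod.isLocalRing_prime_pow hp hn
  have : NeZero (p ^ n) := ⟨(pow_pos hp.pos n).ne'⟩
  have : Fact (Nat.Prime 3) := ⟨Nat.prime_three⟩
  have hdvd : 3 ∣ Fintype.card (ZMod (p ^ n))ˣ := by
    rw [ZMod.card_units_eq_totient, Nat.totient_prime_pow hp (Nat.pos_of_ne_zero hn)]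
    exact Dvd.dvd.mul_left (by omega) _
  obtain ⟨w, hw⟩ := exists_prime_orderOf_dvd_card 3 hdvd
  have hw3 : (w : ZMod (p ^ n)) ^ 3 = 1 := by
    rw [← Units.val_pow_eq_pow_val, ← hw, pow_orderOf_eq_one, Units.val_one]
  have hw1 : (w : ZMod (p ^ n)) ≠ 1 := by
    intro h
    rw [Units.val_eq_one.mp h, orderOf_one] at hw
    omega
  have hu3 : IsUnit ((1 + w + w ^ 2 : ZMod (p ^ n)) + -((w - 1) * (w + 2))) := by
    convert ZMod.isUnit_natCast_prime_pow (n := n) hp Nat.prime_three (by omega) using 1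
    push_cast
    ring
  have hz : ((w : ZMod (p ^ n)) - 1) * (1 + w + w ^ 2) = 0 := by linear_combination hw3
  refine ⟨w, ?_⟩
  rcases IsLocalRing.isUnit_or_isUnit_of_isUnit_add hu3 with h | h
  · exact absurd (sub_eq_zero.mp (h.mul_left_eq_zero.mp hz)) hw1
  · exact (isUnit_of_mul_isUnit_left ((IsUnit.neg_iff _).mp h)).mul_right_eq_zero.mp hz

theorem ZMod.card_one_add_add_sq_eq_zero_prime_pow {p n : ℕ} (hp : p.Prime) (hn : n ≠ 0)
    (h3 : p % 3 = 1) : Nat.card {u : ZMod (p ^ n) // 1 + u + u ^ 2 = 0} = 2 := by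
  have := ZMod.isLocalRing_prime_pow hp hn
  obtain ⟨w, hw⟩ := ZMod.exists_one_add_add_sq_eq_zero hp hn h3
  have h : IsUnit (w - (-1 - w)) := by
    refine isUnit_of_mul_isUnit_left (y := -(w - (-1 - w))) ?_
    convert ZMod.isUnit_natCast_prime_pow (n := n) hp Nat.prime_three (by omega) using 1
    push_cast
    linear_combination (-4) * hw
  refine (Nat.card_congr (Equiv.subtypeEquivRight fun u => ?_)).trans
    (IsLocalRing.card_quadratic_roots h)
  rw [show (u - w) * (u - (-1 - w)) = 1 + u + u ^ 2 by linear_combination (-1) * hw]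

theorem Nat.card_isUnit (R : Type*) [Monoid R] : Nat.card {x : R // IsUnit x} = Nat.card Rˣ :=
  Nat.card_congr ⟨fun x => x.2.unit, fun u => ⟨u, u.isUnit⟩, fun _ => rfl, fun _ => Units.ext rfl⟩

theorem ZMod.card_isCoprime_prime_pow {p n : ℕ} (hp : p.Prime) (hn : n ≠ 0) :
    (Nat.card {x : ZMod (p ^ n) × ZMod (p ^ n) // IsCoprime x.1 x.2} : ℚ) =
      ((p : ℚ) ^ n) ^ 2 * (1 - ((p : ℚ)⁻¹) ^ 2) := by
  have := ZMod.isLocalRing_prime_pow hp hn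
  have : NeZero (p ^ n) := ⟨(pow_pos hp.pos n).ne'⟩
  set R := ZMod (p ^ n) with hR
  have hcompl {α : Type} [Finite α] (P : α → Prop) :
      (Nat.card {x : α // P x} : ℚ) = Nat.card α - Nat.card {x : α // ¬ P x} := by
    classical
    rw [← Nat.card_congr (Equiv.sumCompl P), Nat.card_sum]
    push_cast
    ring
  have hcard : (Nat.card R : ℚ) = (p : ℚ) ^ n := by simp [hR]
  have hunits : (Nat.card {x : R // IsUnit x} : ℚ) = (p : ℚ) ^ n * (1 - (p : ℚ)⁻¹) := by
    rw [Nat.card_isUnit, Nat.card_eq_fintype_card, ZMod.card_units_eq_totient,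
      Nat.totient_eq_mul_prod_factors, Nat.primeFactors_prime_pow hn hp]
    simp
  have hnon : (Nat.card {x : R // ¬ IsUnit x} : ℚ) = (p : ℚ) ^ n * (p : ℚ)⁻¹ := by
    have := hcompl fun x : R => IsUnit x
    rw [hunits, hcard] at this
    linear_combination this
  have hprod : Nat.card {x : R × R // ¬ IsCoprime x.1 x.2} =
      Nat.card {x : R // ¬ IsUnit x} * Nat.card {x : R // ¬ IsUnit x} := by
    rw [← Nat.card_prod]
    refine Nat.card_congr ((Equiv.subtypeEquivRight fun x => ?_).trans
      (Equiv.subtypeProdEquivProd (p := fun x : R => ¬ IsUnit x) (q := fun x : R => ¬ IsUnit x)))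
    rw [IsLocalRing.isCoprime_iff, not_or]
  rw [hcompl, hprod, Nat.card_prod]
  push_cast
  rw [hnon, hcard]
  ring

theorem ZMod.card_sq_eq_one {v : ℕ} (hv : v ≠ 0) (hodd : Odd v) :
    Nat.card {u : ZMod v // u ^ 2 = 1} = 2 ^ v.primeFactors.card := by
  rw [Nat.multiplicative_factorization (fun v => Nat.card {u : ZMod v // u ^ 2 = 1})
    (fun _ _ => ZMod.card_sq_eq_one_mul) ?_ hv, Finsupp.prod, Nat.support_factorization,
    ← Finset.prod_const]
  · refine Finset.prod_congr rfl fun p hp => ?_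
    refine ZMod.card_sq_eq_one_prime_pow (Nat.prime_of_mem_primeFactors hp)
      (Finsupp.mem_support_iff.mp (by simpa using hp)) ?_
    rintro rfl
    exact (Nat.not_even_iff_odd.mpr hodd) (even_iff_two_dvd.mpr (Nat.dvd_of_mem_primeFactors hp))
  · have : Unique {u : ZMod 1 // u ^ 2 = 1} := ⟨⟨1, one_pow 2⟩, fun _ => Subsingleton.elim _ _⟩
    exact Nat.card_unique

theorem ZMod.card_one_add_add_sq_eq_zero {v : ℕ} (hv : v ≠ 0)
    (hp : ∀ p ∈ v.primeFactors, p % 3 = 1) :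
    Nat.card {u : ZMod v // 1 + u + u ^ 2 = 0} = 2 ^ v.primeFactors.card := by
  refine (Nat.multiplicative_factorization
    (fun v => Nat.card {u : ZMod v // 1 + u + u ^ 2 = 0})
    (fun _ _ => ZMod.card_one_add_add_sq_eq_zero_mul) ?_ hv).trans ?_
  rotate_left
  · rw [Finsupp.prod, Nat.support_factorization, ← Finset.prod_const]
    refine Finset.prod_congr rfl fun p h => ?_
    exact ZMod.card_one_add_add_sq_eq_zero_prime_pow (Nat.prime_of_mem_primeFactors h)
      (Finsupp.mem_support_iff.mp (by simpa using h)) (hp p h)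
  · have : Unique {u : ZMod 1 // 1 + u + u ^ 2 = 0} :=
      ⟨⟨0, Subsingleton.elim _ _⟩, fun _ => Subsingleton.elim _ _⟩
    exact Nat.card_unique

theorem ZMod.card_isCoprime {v : ℕ} (hv : v ≠ 0) :
    (Nat.card {x : ZMod v × ZMod v // IsCoprime x.1 x.2} : ℚ) =
      Nat.totient v * (v * ∏ p ∈ v.primeFactors, (1 + 1 / (p : ℚ))) := by
  rw [Nat.multiplicative_factorization
    (fun v => Nat.card {x : ZMod v × ZMod v // IsCoprime x.1 x.2})
    (fun _ _ => ZMod.card_isCoprime_mul) ?_ hv, Finsupp.prod, Nat.support_factorization]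
  · have hvp : (v : ℚ) = ∏ p ∈ v.primeFactors, (p : ℚ) ^ v.factorization p := by
      conv_lhs => rw [← Nat.prod_factorization_pow_eq_self hv]
      rw [Finsupp.prod, Nat.support_factorization]
      push_cast
      rfl
    rw [Nat.totient_eq_mul_prod_factors]
    conv_rhs => rw [hvp]
    push_cast
    rw [← Finset.prod_mul_distrib, ← Finset.prod_mul_distrib, ← Finset.prod_mul_distrib]
    refine Finset.prod_congr rfl fun p h => ?_
    rw [ZMod.card_isCoprime_prime_pow (Nat.prime_of_mem_primeFactors h)
      (Finsupp.mem_support_iff.mp (by simpa using h))]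
    ring
  · have : Unique {x : ZMod 1 × ZMod 1 // IsCoprime x.1 x.2} :=
      ⟨⟨0, 0, 0, Subsingleton.elim _ _⟩, fun _ => Subsingleton.elim _ _⟩
    exact Nat.card_unique

/-! ### Primitive triples with sum zero -/

/-- Triples in `R` with sum zero whose entries generate the unit ideal. -/
@[ext]
structure ZeroSumTriple (R : Type*) [CommRing R] where
  /-- The entries of the triple. -/
  toFun : Fin 3 → R
  sum_eq_zero : ∑ i, toFun i = 0
  exists_sum_mul_eq_one : ∃ c : Fin 3 → R, ∑ i, c i * toFun i = 1

namespace ZeroSumTriple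

variable {R : Type*} [CommRing R]

instance : CoeFun (ZeroSumTriple R) fun _ => Fin 3 → R := ⟨toFun⟩

theorem toFun_injective : Function.Injective (toFun (R := R)) := fun _ _ => ZeroSumTriple.ext

theorem eq_of_forall_apply {f g : ZeroSumTriple R} (h : ∀ i, f i = g i) : f = g :=
  ZeroSumTriple.ext (funext h)

instance [Finite R] : Finite (ZeroSumTriple R) := Finite.of_injective _ toFun_injective

/-- Permutations of the positions and units of `R` act on primitive zero-sum triples. -/
instance : MulAction (Equiv.Perm (Fin 3) × Rˣ) (ZeroSumTriple R) where
  smul g f := ⟨fun i => g.2 * f (g.1⁻¹ i), by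
    rw [← Finset.mul_sum, Equiv.sum_comp g.1⁻¹ f.toFun, f.sum_eq_zero, mul_zero], by
    obtain ⟨c, hc⟩ := f.exists_sum_mul_eq_one
    refine ⟨fun i => ↑g.2⁻¹ * c (g.1⁻¹ i), ?_⟩
    rw [← hc, ← Equiv.sum_comp g.1⁻¹ fun i => c i * f.toFun i]
    refine Finset.sum_congr rfl fun i _ => ?_
    linear_combination (c (g.1⁻¹ i) * f.toFun (g.1⁻¹ i)) * g.2.inv_mul⟩
  one_smul f := eq_of_forall_apply fun i => by
    change ((1 : Rˣ) : R) * f i = f i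
    simp
  mul_smul g h f := eq_of_forall_apply fun i => by
    change ((g.2 * h.2 : Rˣ) : R) * f ((g.1 * h.1)⁻¹ i) = g.2 * (h.2 * f (h.1⁻¹ (g.1⁻¹ i)))
    simp [mul_assoc]

theorem smul_apply (g : Equiv.Perm (Fin 3) × Rˣ) (f : ZeroSumTriple R) (i : Fin 3) :
    (g • f) i = g.2 * f (g.1⁻¹ i) := rfl

theorem smul_eq_iff {σ : Equiv.Perm (Fin 3)} {u : Rˣ} {f g : ZeroSumTriple R} :
    (σ, u) • f = g ↔ ∀ i, g (σ i) = u * f i := by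
  constructor
  · rintro rfl i
    simp [smul_apply]
  · intro h
    refine eq_of_forall_apply fun i => ?_
    rw [smul_apply, ← h]
    simp

theorem univ_eq_of_ne : ∀ {i j k : Fin 3}, i ≠ j → i ≠ k → j ≠ k →
    (Finset.univ : Finset (Fin 3)) = {i, j, k} := by
  decide

theorem forall_iff_of_ne {i j k : Fin 3} (hij : i ≠ j) (hik : i ≠ k) (hjk : j ≠ k)
    {P : Fin 3 → Prop} : (∀ x, P x) ↔ P i ∧ P j ∧ P k := by
  have h := univ_eq_of_ne hij hik hjk
  constructor
  · exact fun H => ⟨H i, H j, H k⟩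
  · rintro ⟨hi, hj, hk⟩ x
    have hx := Finset.mem_univ x
    simp only [h, Finset.mem_insert, Finset.mem_singleton] at hx
    rcases hx with rfl | rfl | rfl <;> assumption

theorem sum_eq_of_ne {i j k : Fin 3} (hij : i ≠ j) (hik : i ≠ k) (hjk : j ≠ k)
    (f : Fin 3 → R) : ∑ x, f x = f i + f j + f k := by
  rw [univ_eq_of_ne hij hik hjk, Finset.sum_insert (by simp [hij, hik]),
    Finset.sum_pair hjk, add_assoc]

theorem add_add_eq_zero (f : ZeroSumTriple R) {i j k : Fin 3} (hij : i ≠ j) (hik : i ≠ k)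
    (hjk : j ≠ k) : f i + f j + f k = 0 := by
  rw [← sum_eq_of_ne hij hik hjk f.toFun]
  exact f.sum_eq_zero

theorem isUnit_of_forall_dvd (f : ZeroSumTriple R) {r : R} (h : ∀ i, r ∣ f i) : IsUnit r := by
  obtain ⟨c, hc⟩ := f.exists_sum_mul_eq_one
  exact isUnit_of_dvd_one (hc ▸ Finset.dvd_sum fun i _ => (h i).mul_left _)

theorem isUnit_of_eq_mul (f : ZeroSumTriple R) {i j : Fin 3} (hij : i ≠ j) {r : R}
    (h : f j = r * f i) : IsUnit (f i) := by
  obtain ⟨k, hik, hjk⟩ : ∃ k, i ≠ k ∧ j ≠ k := by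
    clear h
    revert i j
    decide
  refine f.isUnit_of_forall_dvd ((forall_iff_of_ne hij hik hjk).mpr
    ⟨dvd_rfl, ⟨r, by rw [h, mul_comm]⟩, ⟨-1 - r, ?_⟩⟩)
  linear_combination f.add_add_eq_zero hij hik hjk - h

/-- Primitive zero-sum triples are determined by a coprime pair of coordinates. -/
theorem card_eq (R : Type*) [CommRing R] :
    Nat.card (ZeroSumTriple R) = Nat.card {x : R × R // IsCoprime x.1 x.2} := by
  refine Nat.card_congr
    { toFun := fun f => ⟨(f 0, f 1), ?_⟩
      invFun := fun x => ⟨![x.1.1, x.1.2, -x.1.1 - x.1.2], ?_, ?_⟩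
      left_inv := fun f => ?_
      right_inv := fun x => rfl }
  · obtain ⟨c, hc⟩ := f.exists_sum_mul_eq_one
    have h := f.sum_eq_zero
    rw [Fin.sum_univ_three] at hc h
    exact ⟨c 0 - c 2, c 1 - c 2, by linear_combination hc - c 2 * h⟩
  · simp [Fin.sum_univ_three]
  · obtain ⟨a, b, h⟩ := x.2
    exact ⟨![a, b, 0], by simpa [Fin.sum_univ_three] using h⟩
  · have h := f.sum_eq_zero
    rw [Fin.sum_univ_three] at h
    refine eq_of_forall_apply fun i => ?_
    fin_cases i
    · rfl
    · rfl
    · change -f.toFun 0 - f.toFun 1 = f.toFun 2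
      linear_combination -h

/-! ### Fixed points -/

theorem card_fixed_eq {σ : Equiv.Perm (Fin 3)} {i j k : Fin 3} (hij : i ≠ j) (hik : i ≠ k)
    (hjk : j ≠ k) (hσ : σ i = j) {h : R → Fin 3 → R}
    (hi : ∀ u, h u i = 1) (hj : ∀ u, h u j = u) (hk : ∀ u, h u k = -1 - u) :
    Nat.card {p : Rˣ × ZeroSumTriple R // (σ, p.1) • p.2 = p.2} =
      Nat.card {u : Rˣ // ∀ x, h u (σ x) = u * h u x} * Nat.card Rˣ := by
  rw [← Nat.card_prod]
  have sum_h (u : R) : ∑ x, h u x = 0 := by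
    rw [sum_eq_of_ne hij hik hjk, hi, hj, hk]
    ring
  let t (u c : Rˣ) : ZeroSumTriple R := ⟨fun x => c * h u x, by
    rw [← Finset.mul_sum, sum_h, mul_zero], by
    refine ⟨fun x => if x = i then ↑c⁻¹ else 0, ?_⟩
    simp [hi]⟩
  have ht (u c : Rˣ) (x : Fin 3) : t u c x = c * h u x := rfl
  symm
  refine Nat.card_eq_of_bijective
    (fun q : {u : Rˣ // ∀ x, h u (σ x) = u * h u x} × Rˣ =>
      (⟨(q.1.1, t q.1.1 q.2), smul_eq_iff.mpr fun x => by
        rw [ht, ht, q.1.2 x]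
        ring⟩ : {p : Rˣ × ZeroSumTriple R // (σ, p.1) • p.2 = p.2})) ⟨?_, ?_⟩
  · rintro ⟨⟨u, hu⟩, c⟩ ⟨⟨u', hu'⟩, c'⟩ H
    have H1 : (u, t u c) = (u', t u' c') := congrArg Subtype.val H
    obtain ⟨rfl, H2⟩ := Prod.mk.inj H1
    have H3 : t u c i = t u c' i := by rw [H2]
    rw [ht, ht, hi, mul_one, mul_one, Units.val_inj] at H3
    rw [H3]
  · rintro ⟨⟨u, f⟩, hf⟩
    have hf' : ∀ x, f (σ x) = u * f x := smul_eq_iff.mp hf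
    have hfj : f j = u * f i := hσ ▸ hf' i
    obtain ⟨c, hc⟩ := f.isUnit_of_eq_mul hij hfj
    have hfx : ∀ x, f x = c * h u x := by
      refine (forall_iff_of_ne hij hik hjk).mpr ⟨?_, ?_, ?_⟩
      · rw [hi, hc, mul_one]
      · rw [hj, hc, hfj, mul_comm]
      · rw [hk, hc]
        linear_combination f.add_add_eq_zero hij hik hjk - hfj
    refine ⟨(⟨u, fun x => ?_⟩, c),
      Subtype.ext (Prod.ext rfl (eq_of_forall_apply fun x => (hfx x).symm))⟩
    refine c.isUnit.mul_left_cancel ?_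
    rw [← hfx, hf', hfx]
    ring

theorem card_units_subtype {P : R → Prop} (h : ∀ u, P u → IsUnit u) :
    Nat.card {u : Rˣ // P u} = Nat.card {u : R // P u} :=
  Nat.card_congr
    { toFun := fun u => ⟨u.1, u.2⟩
      invFun := fun u => ⟨(h u.1 u.2).unit, u.2⟩
      left_inv := fun _ => Subtype.ext (Units.ext rfl)
      right_inv := fun _ => rfl }

theorem card_fixed_transposition {σ : Equiv.Perm (Fin 3)} {i j k : Fin 3} (hij : i ≠ j)
    (hik : i ≠ k) (hjk : j ≠ k) (hi : σ i = j) (hj : σ j = i) (hk : σ k = k) :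
    Nat.card {p : Rˣ × ZeroSumTriple R // (σ, p.1) • p.2 = p.2} =
      Nat.card {u : R // u ^ 2 = 1} * Nat.card Rˣ := by
  let h (u : R) (x : Fin 3) : R := if x = i then 1 else if x = j then u else -1 - u
  have h1 (u : R) : h u i = 1 := if_pos rfl
  have h2 (u : R) : h u j = u := by simp [h, hij.symm]
  have h3 (u : R) : h u k = -1 - u := by simp [h, hik.symm, hjk.symm]
  rw [card_fixed_eq hij hik hjk hi h1 h2 h3, ← card_units_subtype (P := fun u : R => u ^ 2 = 1)
    fun u hu => IsUnit.of_mul_eq_one u (by rw [← pow_two, hu])]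
  congr 1
  refine Nat.card_congr (Equiv.subtypeEquivRight fun u => ?_)
  rw [forall_iff_of_ne hij hik hjk, hi, hj, hk, h1, h2, h3]
  constructor
  · rintro ⟨-, h, -⟩
    linear_combination -h
  · intro h
    refine ⟨?_, ?_, ?_⟩
    · ring
    · linear_combination -h
    · linear_combination h

theorem card_fixed_cycle {σ : Equiv.Perm (Fin 3)} {i j k : Fin 3} (hij : i ≠ j)
    (hik : i ≠ k) (hjk : j ≠ k) (hi : σ i = j) (hj : σ j = k) (hk : σ k = i) :
    Nat.card {p : Rˣ × ZeroSumTriple R // (σ, p.1) • p.2 = p.2} =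
      Nat.card {u : R // 1 + u + u ^ 2 = 0} * Nat.card Rˣ := by
  let h (u : R) (x : Fin 3) : R := if x = i then 1 else if x = j then u else -1 - u
  have h1 (u : R) : h u i = 1 := if_pos rfl
  have h2 (u : R) : h u j = u := by simp [h, hij.symm]
  have h3 (u : R) : h u k = -1 - u := by simp [h, hik.symm, hjk.symm]
  rw [card_fixed_eq hij hik hjk hi h1 h2 h3,
    ← card_units_subtype (P := fun u : R => 1 + u + u ^ 2 = 0)
      fun u hu => IsUnit.of_mul_eq_one (-1 - u) (by linear_combination -hu)]
  congr 1
  refine Nat.card_congr (Equiv.subtypeEquivRight fun u => ?_)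
  rw [forall_iff_of_ne hij hik hjk, hi, hj, hk, h1, h2, h3]
  constructor
  · rintro ⟨-, h, -⟩
    linear_combination -h
  · intro h
    refine ⟨?_, ?_, ?_⟩
    · ring
    · linear_combination -h
    · linear_combination h

theorem card_fixed_one :
    Nat.card {p : Rˣ × ZeroSumTriple R // ((1 : Equiv.Perm (Fin 3)), p.1) • p.2 = p.2} =
      Nat.card (ZeroSumTriple R) := by
  refine Nat.card_eq_of_bijective (fun p => p.1.2) ⟨?_, fun f => ⟨⟨(1, f), one_smul _ f⟩, rfl⟩⟩
  have key (p : {p : Rˣ × ZeroSumTriple R // ((1 : Equiv.Perm (Fin 3)), p.1) • p.2 = p.2}) :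
      p.1.1 = 1 := by
    obtain ⟨⟨u, f⟩, hp⟩ := p
    have h := smul_eq_iff.mp hp
    obtain ⟨c, hc⟩ := f.exists_sum_mul_eq_one
    have h' : ∑ i, c i * f i = ∑ i, u * (c i * f i) :=
      Finset.sum_congr rfl fun i _ => by
        have := h i
        simp only [Equiv.Perm.one_apply] at this
        linear_combination c i * this
    rw [← Finset.mul_sum, hc, mul_one] at h'
    exact Units.ext h'.symm
  intro p q hpq
  exact Subtype.ext (Prod.ext ((key p).trans (key q).symm) hpq)

/-- The set of orbits of primitive zero-sum triples. -/
abbrev Orbits (R : Type*) [CommRing R] : Type _ :=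
  Quotient (MulAction.orbitRel (Equiv.Perm (Fin 3) × Rˣ) (ZeroSumTriple R))

theorem card_orbits [Finite R] :
    Nat.card (Orbits R) * (6 * Nat.card Rˣ) =
      Nat.card (ZeroSumTriple R) + 3 * (Nat.card {u : R // u ^ 2 = 1} * Nat.card Rˣ) +
        2 * (Nat.card {u : R // 1 + u + u ^ 2 = 0} * Nat.card Rˣ) := by
  have hG : Nat.card (Equiv.Perm (Fin 3) × Rˣ) = 6 * Nat.card Rˣ := by
    rw [Nat.card_prod, Nat.card_eq_fintype_card, Fintype.card_perm, Fintype.card_fin]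
    rfl
  rw [← hG, ← Nat.card_prod, ← Nat.card_congr (MulAction.sigmaFixedByEquivOrbitsProdGroup
    (Equiv.Perm (Fin 3) × Rˣ) (ZeroSumTriple R))]
  have e : (Σ g : Equiv.Perm (Fin 3) × Rˣ, MulAction.fixedBy (ZeroSumTriple R) g) ≃
      Σ σ : Equiv.Perm (Fin 3), {p : Rˣ × ZeroSumTriple R // (σ, p.1) • p.2 = p.2} :=
    { toFun := fun x => ⟨x.1.1, ⟨(x.1.2, x.2.1), x.2.2⟩⟩
      invFun := fun x => ⟨(x.1, x.2.1.1), ⟨x.2.1.2, x.2.2⟩⟩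
      left_inv := fun _ => rfl
      right_inv := fun _ => rfl }
  have huniv : (Finset.univ : Finset (Equiv.Perm (Fin 3))) =
      {1, Equiv.swap 0 1, Equiv.swap 0 2, Equiv.swap 1 2, finRotate 3, (finRotate 3)⁻¹} := by
    decide
  rw [Nat.card_congr e, Nat.card_sigma, huniv, Finset.sum_insert (by decide),
    Finset.sum_insert (by decide), Finset.sum_insert (by decide), Finset.sum_insert (by decide),
    Finset.sum_pair (by decide), card_fixed_one,
    card_fixed_transposition (σ := Equiv.swap 0 1) (i := 0) (j := 1) (k := 2)
      (by decide) (by decide) (by decide) (by decide) (by decide) (by decide),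
    card_fixed_transposition (σ := Equiv.swap 0 2) (i := 0) (j := 2) (k := 1)
      (by decide) (by decide) (by decide) (by decide) (by decide) (by decide),
    card_fixed_transposition (σ := Equiv.swap 1 2) (i := 1) (j := 2) (k := 0)
      (by decide) (by decide) (by decide) (by decide) (by decide) (by decide),
    card_fixed_cycle (σ := finRotate 3) (i := 0) (j := 1) (k := 2)
      (by decide) (by decide) (by decide) (by decide) (by decide) (by decide),
    card_fixed_cycle (σ := (finRotate 3)⁻¹) (i := 0) (j := 2) (k := 1)
      (by decide) (by decide) (by decide) (by decide) (by decide) (by decide)]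
  ring

/-! ### Degenerate triples -/

/-- The triple `(1, 1, -2)`. -/
def repeated (R : Type*) [CommRing R] : ZeroSumTriple R :=
  ⟨![1, 1, -2], by rw [Fin.sum_univ_three]; simp; ring,
    ![1, 0, 0], by simp [Fin.sum_univ_three]⟩

/-- The triple `(1, -1, 0)`. -/
def progression (R : Type*) [CommRing R] : ZeroSumTriple R :=
  ⟨![1, -1, 0], by simp [Fin.sum_univ_three], ![1, 0, 0], by simp [Fin.sum_univ_three]⟩

/-- The orbit of a primitive zero-sum triple. -/
def orbitMk (f : ZeroSumTriple R) : Orbits R := Quotient.mk _ f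

theorem orbitMk_eq_iff {f g : ZeroSumTriple R} :
    orbitMk f = orbitMk g ↔ ∃ σ : Equiv.Perm (Fin 3), ∃ u : Rˣ, ∀ i, f (σ i) = u * g i := by
  unfold orbitMk
  rw [Quotient.eq, MulAction.orbitRel_apply, MulAction.mem_orbit_iff]
  simp_rw [← smul_eq_iff]
  exact Prod.exists

theorem exists_perm_of_ne : ∀ {i j : Fin 3}, i ≠ j →
    ∃ σ : Equiv.Perm (Fin 3), σ 0 = i ∧ σ 1 = j := by
  decide

theorem orbitMk_eq_of_apply {f g : ZeroSumTriple R} {i j : Fin 3} (hij : i ≠ j) {u : R}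
    (hf : f j = u * f i) (hg : g 1 = u * g 0) (hg0 : g 0 = 1) : orbitMk f = orbitMk g := by
  obtain ⟨σ, hi, hj⟩ := exists_perm_of_ne hij
  obtain ⟨c, hc⟩ := f.isUnit_of_eq_mul hij hf
  refine orbitMk_eq_iff.mpr ⟨σ, c, ?_⟩
  have hfsum := f.add_add_eq_zero (i := σ 0) (j := σ 1) (k := σ 2) (by simp) (by simp) (by simp)
  have hgsum := g.add_add_eq_zero (i := 0) (j := 1) (k := 2) (by decide) (by decide) (by decide)
  rw [hi, hj] at hfsum
  refine Fin.forall_fin_succ.mpr ⟨?_, Fin.forall_fin_two.mpr ⟨?_, ?_⟩⟩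
  · rw [hi, hc, hg0, mul_one]
  · change f (σ 1) = c * g 1
    rw [hj, hf, hg, hg0, hc]
    ring
  · change f (σ 2) = c * g 2
    rw [hc]
    linear_combination hfsum - f i * hgsum - hf + f i * hg + (f i + f i * u) * hg0

/-- The degenerate triples form exactly two orbits. -/
theorem orbitMk_mem_iff {f : ZeroSumTriple R} :
    orbitMk f ∈ ({orbitMk (repeated R), orbitMk (progression R)} : Set (Orbits R)) ↔
      ¬ (Function.Injective f.toFun ∧ ∀ i, f i ≠ 0) := by
  rw [Set.mem_insert_iff, Set.mem_singleton_iff]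
  constructor
  · rintro (h | h) ⟨h1, h2⟩
    · obtain ⟨σ, u, h⟩ := orbitMk_eq_iff.mp h
      have : σ 0 = σ 1 := h1 ((h 0).trans (h 1).symm)
      simp at this
    · obtain ⟨σ, u, h⟩ := orbitMk_eq_iff.mp h
      exact h2 (σ 2) ((h 2).trans (mul_zero _))
  · intro h
    by_cases h1 : Function.Injective f.toFun
    · have h2 : ∃ k, f k = 0 := by
        by_contra! h2
        exact h ⟨h1, h2⟩
      obtain ⟨k, hk⟩ := h2
      obtain ⟨i, j, hij, hik, hjk⟩ : ∃ i j, i ≠ j ∧ i ≠ k ∧ j ≠ k := by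
        clear hk
        revert k
        decide
      refine .inr (orbitMk_eq_of_apply hij (u := -1) ?_ ?_ rfl)
      · linear_combination f.add_add_eq_zero hij hik hjk - hk
      · simp [progression]
    · simp only [Function.Injective, not_forall] at h1
      obtain ⟨i, j, hf, hij⟩ := h1
      exact .inl (orbitMk_eq_of_apply hij (u := 1) (by rw [one_mul]; exact hf.symm)
        (by simp [repeated]) rfl)

theorem orbitMk_repeated_ne [Nontrivial R] (h2 : IsUnit (2 : R)) :
    orbitMk (repeated R) ≠ orbitMk (progression R) := by
  intro h
  obtain ⟨σ, u, h⟩ := orbitMk_eq_iff.mp h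
  have h0 : repeated R (σ 2) = 0 := (h 2).trans (mul_zero _)
  have hne : ∀ i, repeated R i ≠ 0 := by
    intro i
    fin_cases i
    · exact one_ne_zero
    · exact one_ne_zero
    · exact neg_ne_zero.mpr h2.ne_zero
  exact hne _ h0

end ZeroSumTriple

/-! ### Base lines and zero-sum triples -/

theorem card_sub_image_eq_seven_iff {R : Type*} [CommRing R] [DecidableEq R]
    (h2 : IsUnit (2 : R)) (h3 : IsUnit (3 : R)) {f : Fin 3 → R} (hsum : ∑ i, f i = 0)
    (hf : Function.Injective f) {X : Finset R} {b : R}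
    (hX : X = Finset.univ.image fun i => f i + b) :
    (X - X).card = 7 ↔ ∀ i, f i ≠ 0 := by
  have hdiff : X - X = (([0, f 0 - f 1, f 1 - f 0, f 0 - f 2, f 2 - f 0, f 1 - f 2, f 2 - f 1] :
      List R) : Multiset R).toFinset := by
    ext t
    have hmem : t ∈ X - X ↔ ∃ i j, f i - f j = t := by
      simp [hX, Finset.mem_sub]
    simp only [hmem, Fin.exists_fin_succ, Multiset.mem_toFinset, Multiset.mem_coe, List.mem_cons,
      List.not_mem_nil, or_false, Fin.succ_zero_eq_one, Fin.succ_one_eq_two, IsEmpty.exists_iff,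
      sub_self]
    grind
  rw [Fin.sum_univ_three] at hsum
  have h01 : f 0 ≠ f 1 := hf.ne (by decide)
  have h02 : f 0 ≠ f 2 := hf.ne (by decide)
  have h12 : f 1 ≠ f 2 := hf.ne (by decide)
  have c2 : ∀ x : R, 2 * x = 0 → x = 0 := fun x => h2.mul_right_eq_zero.mp
  have c3 : ∀ x : R, 3 * x = 0 → x = 0 := fun x => h3.mul_right_eq_zero.mp
  have hall : (∀ i, f i ≠ 0) ↔ f 0 ≠ 0 ∧ f 1 ≠ 0 ∧ f 2 ≠ 0 := by
    simp [Fin.forall_fin_succ]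
  have hcard := Multiset.toFinset_card_eq_card_iff_nodup
    (m := (([0, f 0 - f 1, f 1 - f 0, f 0 - f 2, f 2 - f 0, f 1 - f 2, f 2 - f 1] : List R) :
      Multiset R))
  rw [hdiff, hall]
  refine hcard.trans ?_
  rw [Multiset.coe_nodup]
  simp only [List.nodup_cons, List.mem_cons, List.not_mem_nil, not_or, or_false, List.nodup_nil,
    and_true, not_false_eq_true]
  generalize f 0 = x at *
  generalize f 1 = y at *
  generalize f 2 = z at *
  have hxy := c2 (x - y)
  have hxz := c2 (x - z)
  have hyz := c2 (y - z)
  have hx := c3 x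
  have hy := c3 y
  have hz := c3 z
  clear hcard hall hdiff c2 c3 hX hf
  constructor
  · intro h
    refine ⟨?_, ?_, ?_⟩ <;> rintro rfl <;> grind
  · rintro ⟨h0, h1, h2⟩
    refine ⟨⟨?_, ?_, ?_, ?_, ?_, ?_⟩, ⟨?_, ?_, ?_, ?_, ?_⟩, ⟨?_, ?_, ?_, ?_⟩, ⟨?_, ?_, ?_⟩,
      ⟨?_, ?_⟩, ?_⟩ <;> grind

theorem closure_eq_top_iff {v : ℕ} [NeZero v] (h3 : IsUnit (3 : ZMod v)) {f : Fin 3 → ZMod v}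
    (hsum : ∑ i, f i = 0) {X : Finset (ZMod v)} {b : ZMod v}
    (hX : X = Finset.univ.image fun i => f i + b) :
    AddSubgroup.closure ((X - X : Finset (ZMod v)) : Set (ZMod v)) = ⊤ ↔
      ∃ c : Fin 3 → ZMod v, ∑ i, c i * f i = 1 := by
  have hsub : ∀ i j, f i - f j ∈ X - X := by
    intro i j
    rw [hX]
    refine Finset.mem_sub.mpr ⟨f i + b, by simp, f j + b, by simp, by ring⟩
  have hmul : ∀ (H : AddSubgroup (ZMod v)) (c x : ZMod v), x ∈ H → c * x ∈ H := by
    intro H c x hx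
    have := H.nsmul_mem hx c.val
    rwa [nsmul_eq_mul, ZMod.natCast_zmod_val] at this
  constructor
  · intro h
    rw [← Ideal.mem_span_range_iff_exists_fun]
    have hle : AddSubgroup.closure ((X - X : Finset (ZMod v)) : Set (ZMod v)) ≤
        (Ideal.span (Set.range f)).toAddSubgroup := by
      rw [AddSubgroup.closure_le]
      intro t ht
      rw [hX] at ht
      obtain ⟨_, hi, _, hj, rfl⟩ := Finset.mem_sub.mp (Finset.mem_coe.mp ht)
      obtain ⟨i, -, rfl⟩ := Finset.mem_image.mp hi
      obtain ⟨j, -, rfl⟩ := Finset.mem_image.mp hj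
      rw [add_sub_add_right_eq_sub]
      exact sub_mem (Ideal.subset_span ⟨i, rfl⟩) (Ideal.subset_span ⟨j, rfl⟩)
    exact hle (h ▸ AddSubgroup.mem_top 1)
  · rintro ⟨c, hc⟩
    set H := AddSubgroup.closure ((X - X : Finset (ZMod v)) : Set (ZMod v))
    have hfH : ∀ i, f i ∈ H := by
      intro i
      have h : 3 * f i ∈ H := by
        have : 3 * f i = ∑ j, (f i - f j) := by
          rw [Finset.sum_sub_distrib, hsum]
          simp
        rw [this]
        exact sum_mem fun j _ => AddSubgroup.subset_closure (Finset.mem_coe.mpr (hsub i j))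
      obtain ⟨u, hu⟩ := h3
      have := hmul H (↑u⁻¹ : ZMod v) _ h
      rwa [← hu, Units.inv_mul_cancel_left] at this
    have h1 : (1 : ZMod v) ∈ H := hc ▸ sum_mem fun i _ => hmul H _ _ (hfH i)
    refine (AddSubgroup.eq_top_iff' H).mpr fun x => ?_
    simpa using hmul H x 1 h1

theorem mem_Bcon3_iff {v : ℕ} [NeZero v] (h2 : IsUnit (2 : ZMod v)) (h3 : IsUnit (3 : ZMod v))
    {f : Fin 3 → ZMod v} (hsum : ∑ i, f i = 0) {X : Finset (ZMod v)} {b : ZMod v}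
    (hX : X = Finset.univ.image fun i => f i + b) :
    X ∈ Bcon3 v ↔ (Function.Injective f ∧ ∀ i, f i ≠ 0) ∧
      ∃ c : Fin 3 → ZMod v, ∑ i, c i * f i = 1 := by
  have hcard : X.card = 3 ↔ Function.Injective f := by
    have := Finset.card_image_iff (s := (Finset.univ : Finset (Fin 3))) (f := fun i => f i + b)
    rw [hX]
    rw [Finset.card_univ, Fintype.card_fin, Finset.coe_univ, Set.injOn_univ] at this
    rw [this]
    exact ⟨fun h i j hij => h (by simp [hij]), fun h i j hij => h (add_right_cancel hij)⟩
  change X.card = 3 ∧ (X - X).card = 7 ∧ _ ↔ _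
  rw [hcard, closure_eq_top_iff h3 hsum hX, and_assoc]
  exact and_congr_right fun hf => and_congr_left fun _ =>
    card_sub_image_eq_seven_iff h2 h3 hsum hf hX

theorem exists_zeroSumTriple_of_mem_Bcon3 {v : ℕ} [NeZero v] (h2 : IsUnit (2 : ZMod v))
    (h3 : IsUnit (3 : ZMod v)) {X : Finset (ZMod v)} (hX : X ∈ Bcon3 v) :
    ∃ f : ZeroSumTriple (ZMod v), ∃ b, X = Finset.univ.image fun i => f i + b := by
  obtain ⟨x, y, z, -, -, -, hxyz⟩ := Finset.card_eq_three.mp hX.1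
  obtain ⟨s, hs⟩ := h3.dvd (a := x + y + z)
  have hsum : ∑ i, (![x - s, y - s, z - s] : Fin 3 → ZMod v) i = 0 := by
    rw [Fin.sum_univ_three]
    change x - s + (y - s) + (z - s) = 0
    linear_combination hs
  have hX' : X = Finset.univ.image fun i => (![x - s, y - s, z - s] : Fin 3 → ZMod v) i + s := by
    rw [hxyz]
    ext t
    simp [Fin.exists_fin_succ, eq_comm]
  exact ⟨⟨_, hsum, ((mem_Bcon3_iff h2 h3 hsum hX').mp hX).2⟩, s, hX'⟩

theorem exists_perm_of_image_eq {α β : Type*} [Fintype α] [DecidableEq β] {f g : α → β}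
    (hf : Function.Injective f) (hg : Function.Injective g)
    (h : Finset.univ.image f = Finset.univ.image g) : ∃ σ : Equiv.Perm α, ∀ i, f (σ i) = g i := by
  have hr : Set.range g = Set.range f := by
    simpa using (congrArg (fun s : Finset β => (s : Set β)) h).symm
  refine ⟨(Equiv.ofInjective g hg).trans ((Equiv.setCongr hr).trans
    (Equiv.ofInjective f hf).symm), fun i => ?_⟩
  simp [Equiv.apply_ofInjective_symm]

theorem affRel3_iff {v : ℕ} [NeZero v] (h2 : IsUnit (2 : ZMod v)) (h3 : IsUnit (3 : ZMod v))
    {X Y : Bcon3 v} {f g : ZeroSumTriple (ZMod v)} {b c : ZMod v}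
    (hX : (X : Finset (ZMod v)) = Finset.univ.image fun i => f i + b)
    (hY : (Y : Finset (ZMod v)) = Finset.univ.image fun i => g i + c) :
    affRel3 v X Y ↔ ZeroSumTriple.orbitMk f = ZeroSumTriple.orbitMk g := by
  have hf := ((mem_Bcon3_iff h2 h3 f.sum_eq_zero hX).mp X.2).1.1
  have hg := ((mem_Bcon3_iff h2 h3 g.sum_eq_zero hY).mp Y.2).1.1
  rw [eq_comm, ZeroSumTriple.orbitMk_eq_iff]
  unfold affRel3
  rw [hX, hY]
  simp only [Finset.image_image, Function.comp_def]
  constructor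
  · rintro ⟨a, d, h⟩
    obtain ⟨σ, hσ⟩ := exists_perm_of_image_eq
      (fun i j hij => hg (add_right_cancel hij))
      (fun i j hij => hf (add_right_cancel (a.isUnit.mul_left_cancel (add_right_cancel hij)))) h
    have hsum := Finset.sum_congr (rfl : (Finset.univ : Finset (Fin 3)) = _) fun i _ => hσ i
    have hgσ : g (σ 0) + g (σ 1) + g (σ 2) = 0 :=
      g.add_add_eq_zero (by simp) (by simp) (by simp)
    have hfσ : f 0 + f 1 + f 2 = 0 :=
      f.add_add_eq_zero (by decide) (by decide) (by decide)
    have hd : a * b + d - c = 0 := by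
      refine h3.mul_right_eq_zero.mp ?_
      linear_combination hgσ - a * hfσ - hσ 0 - hσ 1 - hσ 2
    refine ⟨σ, a, fun i => ?_⟩
    linear_combination hσ i + hd
  · rintro ⟨σ, a, h⟩
    refine ⟨a, c - a * b, ?_⟩
    have : (fun i => (a : ZMod v) * (f i + b) + (c - a * b)) = (fun i => g i + c) ∘ σ := by
      funext i
      rw [Function.comp_apply, h]
      ring
    rw [this, ← Finset.image_image, Finset.image_univ_equiv]

theorem numOrbits3_eq {v : ℕ} [NeZero v] (h2 : IsUnit (2 : ZMod v)) (h3 : IsUnit (3 : ZMod v)) :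
    numOrbits3 v = Nat.card ↥({ZeroSumTriple.orbitMk (ZeroSumTriple.repeated (ZMod v)),
      ZeroSumTriple.orbitMk (ZeroSumTriple.progression (ZMod v))} :
        Set (ZeroSumTriple.Orbits (ZMod v)))ᶜ := by
  choose F b hF using fun X : Bcon3 v => exists_zeroSumTriple_of_mem_Bcon3 h2 h3 X.2
  refine Nat.card_eq_of_bijective (Quot.lift (fun X => ⟨ZeroSumTriple.orbitMk (F X), ?_⟩) ?_)
    ⟨?_, ?_⟩
  · rw [Set.mem_compl_iff, ZeroSumTriple.orbitMk_mem_iff, not_not]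
    exact ((mem_Bcon3_iff h2 h3 (F X).sum_eq_zero (hF X)).mp X.2).1
  · exact fun X Y h => Subtype.ext ((affRel3_iff h2 h3 (hF X) (hF Y)).mp h)
  · rintro ⟨X⟩ ⟨Y⟩ h
    exact Quot.sound ((affRel3_iff h2 h3 (hF X) (hF Y)).mpr (congrArg Subtype.val h))
  · rintro ⟨⟨f⟩, hf⟩
    have hgood := not_not.mp (mt (ZeroSumTriple.orbitMk_mem_iff (f := f)).mpr hf)
    have hX := (mem_Bcon3_iff h2 h3 (b := 0) f.sum_eq_zero rfl).mpr
      ⟨hgood, f.exists_sum_mul_eq_one⟩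
    let X : Bcon3 v := ⟨_, hX⟩
    have hXX : affRel3 v X X := ⟨1, 0, by simp⟩
    exact ⟨Quot.mk _ X,
      Subtype.ext ((affRel3_iff h2 h3 (Y := X) (c := 0) (hF X) rfl).mp hXX)⟩

/-- for odd `v > 4` all of whose prime divisors are `≡ 1 (mod 3)`,
the number of isomorphism classes of connected cyclic configurations of type (v₃)
is `(1/6)·v·∏(1 + 1/pᵢ) + (5/6)·2^k - 2`. -/
theorem numOrbits3_odd_all_primes_one_mod_three
    (v : ℕ) (hv : 4 < v) (hodd : Odd v)
    (hp : ∀ p ∈ v.primeFactors, p % 3 = 1) :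
    (numOrbits3 v : ℚ) =
      (v : ℚ) / 6 * (∏ p ∈ v.primeFactors, (1 + 1 / (p : ℚ)))
        + 5 / 6 * 2 ^ v.primeFactors.card - 2 := by
  have hv0 : v ≠ 0 := by omega
  have : NeZero v := ⟨hv0⟩
  have : Fact (1 < v) := ⟨by omega⟩
  have h2 : IsUnit (2 : ZMod v) := by
    exact_mod_cast (ZMod.isUnit_iff_coprime 2 v).mpr hodd.coprime_two_left
  have h3 : IsUnit (3 : ZMod v) := by
    have h : Nat.Coprime 3 v := (Nat.Prime.coprime_iff_not_dvd Nat.prime_three).mpr fun hdvd => by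
      have := hp 3 (Nat.mem_primeFactors.mpr ⟨Nat.prime_three, hdvd, hv0⟩)
      omega
    exact_mod_cast (ZMod.isUnit_iff_coprime 3 v).mpr h
  have hpair := Set.ncard_pair (ZeroSumTriple.orbitMk_repeated_ne h2)
  have hnum : numOrbits3 v + 2 = Nat.card (ZeroSumTriple.Orbits (ZMod v)) := by
    rw [numOrbits3_eq h2 h3, Nat.card_coe_set_eq, ← hpair, add_comm, Set.ncard_add_ncard_compl]
  have hcard := ZeroSumTriple.card_orbits (R := ZMod v)
  rw [← hnum, ZeroSumTriple.card_eq, ZMod.card_sq_eq_one hv0 hodd,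
    ZMod.card_one_add_add_sq_eq_zero hv0 hp, Nat.card_eq_fintype_card (α := (ZMod v)ˣ),
    ZMod.card_units_eq_totient] at hcard
  have hφ : (Nat.totient v : ℚ) ≠ 0 := by
    exact_mod_cast (Nat.totient_pos.mpr (by omega)).ne'
  have hcardQ := congrArg (Nat.cast (R := ℚ)) hcard
  push_cast at hcardQ
  rw [ZMod.card_isCoprime hv0] at hcardQ
  refine mul_right_cancel₀ (mul_ne_zero (by norm_num : (6 : ℚ) ≠ 0) hφ) ?_
  linear_combination hcardQ
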